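/- arXiv:1302.1209 — 3 statements merged into one kernel-verified Lean document; each statement's English description precedes it below -/
import Mathlib

section
/- Let η ≥ −1/2 and set ζ = min(4/3, 1 + η). Let β, u0 be real numbers, let Δu : [0, 1) → ℝ be continuous with Δu(x) = O((1 − x)^ζ) as x → 1⁻, and let q_l* : [0, 1) → ℝ be continuous with q_l*(x) = O((1 − x)^η) as x → 1⁻. Define G2(x) for x ∈ [0, 1) by 3(1 − x)·G2(x) = x·∫ₓ¹ Δu(ξ) dξ + (3/28)(3β − 1)·u0·(1 − x)^(7/3) + β·∫ₓ¹ (ξ − x)·q_l*(ξ) dξ. Then G2(x) = O((1 − x)^ζ) as x → 1⁻. -/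
open Filter Topology Asymptotics

/-- Powers of the distance to `1` are ordered by their exponents near `1⁻`. -/
lemma isBigO_one_sub_rpow_of_le {p q : ℝ} (h : q ≤ p) :
    (fun x : ℝ => (1 - x) ^ p) =O[𝓝[<] 1] fun x : ℝ => (1 - x) ^ q := by
  refine IsBigO.of_bound 1 ?_
  filter_upwards [Ioo_mem_nhdsLT (zero_lt_one' ℝ)] with x hx
  have h0 : 0 < 1 - x := by linarith [hx.2]
  rw [one_mul, Real.norm_of_nonneg (by positivity), Real.norm_of_nonneg (by positivity)]
  exact Real.rpow_le_rpow_of_exponent_ge h0 (by linarith [hx.1]) h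

lemma intervalIntegrable_one_sub_rpow {a : ℝ} (ha : -1 < a) (x : ℝ) :
    IntervalIntegrable (fun ξ : ℝ => (1 - ξ) ^ a) MeasureTheory.volume x 1 := by
  have h := (intervalIntegral.intervalIntegrable_rpow' (a := 1 - x) (b := 0) ha).comp_sub_left 1
  simpa using h

lemma integral_one_sub_rpow {a : ℝ} (ha : -1 < a) (x : ℝ) :
    ∫ ξ in x..1, (1 - ξ) ^ a = (1 - x) ^ (a + 1) / (a + 1) := by
  rw [intervalIntegral.integral_comp_sub_left (fun t : ℝ => t ^ a) 1,
    integral_rpow (Or.inl ha), sub_self, Real.zero_rpow (by linarith), sub_zero]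

/-- Integrating `f = O((1 - ξ) ^ a)` over `[x, 1]` against a kernel bounded by `K x` gains one
power of `1 - x`. -/
lemma isBigO_integral_kernel_mul {a : ℝ} (ha : -1 < a) {f K : ℝ → ℝ} {k : ℝ → ℝ → ℝ}
    (hf : f =O[𝓝[<] 1] fun x => (1 - x) ^ a)
    (hk : ∀ x, ∀ ξ ∈ Set.Ioo x 1, ‖k x ξ‖ ≤ K x) :
    (fun x => ∫ ξ in x..1, k x ξ * f ξ) =O[𝓝[<] 1] fun x => K x * (1 - x) ^ (a + 1) := by
  obtain ⟨C, hC⟩ := hf.bound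
  obtain ⟨l, hl, hlC⟩ := (mem_nhdsLT_iff_exists_Ioo_subset).1 hC
  refine IsBigO.of_bound (C / (a + 1)) ?_
  filter_upwards [Ioo_mem_nhdsLT hl] with x hx
  have h0 : 0 < 1 - x := by linarith [hx.2]
  have hK : 0 ≤ K x :=
    (norm_nonneg _).trans (hk x ((x + 1) / 2) ⟨by linarith, by linarith⟩)
  have hbound : ∀ᵐ ξ, ξ ∈ Set.Ioc x 1 → ‖k x ξ * f ξ‖ ≤ K x * C * (1 - ξ) ^ a := by
    filter_upwards [MeasureTheory.Measure.ae_ne MeasureTheory.volume (1 : ℝ)] with ξ hne hξ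
    have hlt : ξ < 1 := lt_of_le_of_ne hξ.2 hne
    have hfξ : ‖f ξ‖ ≤ C * ‖(1 - ξ) ^ a‖ := hlC ⟨hx.1.trans hξ.1, hlt⟩
    rw [Real.norm_of_nonneg (Real.rpow_nonneg (by linarith) a)] at hfξ
    rw [norm_mul, mul_assoc]
    exact mul_le_mul (hk x ξ ⟨hξ.1, hlt⟩) hfξ (norm_nonneg _) hK
  refine (intervalIntegral.norm_integral_le_of_norm_le hx.2.le hbound
    ((intervalIntegrable_one_sub_rpow ha x).const_mul _)).trans (le_of_eq ?_)
  rw [intervalIntegral.integral_const_mul, integral_one_sub_rpow ha,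
    Real.norm_of_nonneg (by positivity)]
  ring

/-- Near-tip estimate for the integral operator `G₂` of the self-similar PKN
solver: with `ζ = min(4/3, 1+η)`, `Δu = O((1-x)^ζ)` and `q_l* = O((1-x)^η)`
as `x → 1⁻`, the function `G₂` defined by
`3(1-x) G₂(x) = x ∫ₓ¹ Δu + (3/28)(3β-1) u0 (1-x)^(7/3) + β ∫ₓ¹ (ξ-x) q_l*(ξ) dξ`
satisfies `G₂ = O((1-x)^ζ)` as `x → 1⁻`. -/
theorem stmt_12 (η : ℝ) (hη : -1 / 2 ≤ η) (β u0 : ℝ)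
    (Δu qlstar G2 : ℝ → ℝ)
    (hΔcont : ContinuousOn Δu (Set.Ico 0 1))
    (hΔ : Δu =O[𝓝[<] 1] fun x => (1 - x) ^ min (4 / 3 : ℝ) (1 + η))
    (hqcont : ContinuousOn qlstar (Set.Ico 0 1))
    (hq : qlstar =O[𝓝[<] 1] fun x => (1 - x) ^ η)
    (hG2 : ∀ x ∈ Set.Ico (0 : ℝ) 1,
      3 * (1 - x) * G2 x
        = x * (∫ ξ in x..1, Δu ξ)
          + (3 / 28) * (3 * β - 1) * u0 * (1 - x) ^ ((7 : ℝ) / 3)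
          + β * ∫ ξ in x..1, (ξ - x) * qlstar ξ) :
    G2 =O[𝓝[<] 1] fun x => (1 - x) ^ min (4 / 3 : ℝ) (1 + η) := by
  set ζ := min (4 / 3 : ℝ) (1 + η)
  have hζ_left : ζ ≤ 4 / 3 := min_le_left _ _
  have hζ_right : ζ ≤ 1 + η := min_le_right _ _
  have hζ_pos : -1 < ζ := lt_min (by norm_num) (by linarith)
  have hone : (fun x : ℝ => x) =O[𝓝[<] 1] fun _ => (1 : ℝ) :=
    (continuous_id.tendsto (1 : ℝ)).isBigO_one ℝ |>.mono nhdsWithin_le_nhds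
  have hΔint : (fun x => x * ∫ ξ in x..1, Δu ξ) =O[𝓝[<] 1] fun x => (1 - x) ^ (ζ + 1) := by
    have h := isBigO_integral_kernel_mul (k := fun _ _ => 1) (K := fun _ => 1) hζ_pos hΔ
      (by simp)
    simpa using hone.mul h
  have hmid : (fun x : ℝ => (3 / 28) * (3 * β - 1) * u0 * (1 - x) ^ ((7 : ℝ) / 3))
      =O[𝓝[<] 1] fun x => (1 - x) ^ (ζ + 1) :=
    (isBigO_one_sub_rpow_of_le (by linarith)).const_mul_left _
  have hqint : (fun x => β * ∫ ξ in x..1, (ξ - x) * qlstar ξ)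
      =O[𝓝[<] 1] fun x => (1 - x) ^ (ζ + 1) := by
    have h := isBigO_integral_kernel_mul (k := fun x ξ => ξ - x) (K := fun x => 1 - x)
      (by linarith) hq fun x ξ hξ => by
        rw [Real.norm_of_nonneg (by linarith [hξ.1])]
        linarith [hξ.2]
    refine IsBigO.const_mul_left (h.trans ?_) _
    refine (isBigO_one_sub_rpow_of_le (p := η + 1 + 1) (by linarith)).congr' ?_ .rfl
    filter_upwards [self_mem_nhdsWithin] with x hx
    rw [Real.rpow_add_one (sub_pos.2 hx).ne' (η + 1), mul_comm]
  have hinv : (fun x : ℝ => (3 * (1 - x))⁻¹) =O[𝓝[<] 1] fun x => (1 - x)⁻¹ := by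
    simp_rw [mul_inv]
    exact (isBigO_refl _ _).const_mul_left _
  refine (hinv.mul ((hΔint.add hmid).add hqint)).congr' ?_ ?_
  · filter_upwards [Ioo_mem_nhdsLT (zero_lt_one' ℝ)] with x hx
    have h0 : 1 - x ≠ 0 := (sub_pos.2 hx.2).ne'
    rw [← hG2 x ⟨hx.1.le, hx.2⟩, inv_mul_cancel_left₀ (by positivity)]
  · filter_upwards [self_mem_nhdsWithin] with x hx
    have h0 : 1 - x ≠ 0 := (sub_pos.2 hx).ne'
    rw [Real.rpow_add_one h0, mul_comm, mul_inv_cancel_right₀ h0]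
end

section
/- Let s(x) = (1/5)·(1 − x)^(1/6) and define h(x) = (1 − x)^(1/3)·(1 + s(x)) for x ∈ [0, 1). Then the function x·h'(x) + 3·(h³h')'(x) is O((1 − x)^(−1/2)) as x → 1⁻, and (1 − x)^(1/2)·[x·h'(x) + 3·(h³h')'(x)] converges to a nonzero limit as x → 1⁻. -/
open Filter Topology Asymptotics

/-- A natural power of `(1 - x) ^ (1/6)` as a real power of `1 - x`. -/
theorem one_sub_rpow_sixth_pow {x : ℝ} (hx : x < 1) (n : ℕ) :
    ((1 - x) ^ ((1 : ℝ) / 6)) ^ n = (1 - x) ^ ((n : ℝ) / 6) := by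
  rw [← Real.rpow_natCast, ← Real.rpow_mul (sub_pos.2 hx).le]
  congr 1
  ring

/-- The derivative of `(1 - x) ^ (1/6)`, written as a rational function of `(1 - x) ^ (1/6)`. -/
theorem hasDerivAt_one_sub_rpow_sixth {x : ℝ} (hx : x < 1) :
    HasDerivAt (fun y : ℝ => (1 - y) ^ ((1 : ℝ) / 6))
      (-(1 / 6) / ((1 - x) ^ ((1 : ℝ) / 6)) ^ 5) x := by
  have hpos : 0 < 1 - x := sub_pos.2 hx
  refine (((hasDerivAt_id x).const_sub 1).rpow_const (p := (1 : ℝ) / 6)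
    (Or.inl hpos.ne')).congr_deriv ?_
  have hpow : ((1 - x) ^ ((1 : ℝ) / 6)) ^ 5 = (1 - x) ^ ((5 : ℝ) / 6) := by
    exact_mod_cast one_sub_rpow_sixth_pow hx 5
  have hexp : (1 : ℝ) / 6 - 1 = -(5 / 6) := by norm_num
  rw [hpow, id, hexp, Real.rpow_neg hpos.le]
  ring

/-- Carter-type benchmark: for `h(x) = (1-x)^(1/3)(1 + (1/5)(1-x)^(1/6))` the
combination `x h'(x) + 3 (h³h')'(x)` is `O((1-x)^(-1/2))` as `x → 1⁻`, and
`(1-x)^(1/2) [x h'(x) + 3 (h³h')'(x)]` converges to a nonzero limit. -/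
theorem stmt_17 (h : ℝ → ℝ)
    (hh : ∀ x ∈ Set.Ico (0 : ℝ) 1,
      h x = (1 - x) ^ ((1 : ℝ) / 3) * (1 + (1 / 5) * (1 - x) ^ ((1 : ℝ) / 6))) :
    ((fun x => x * deriv h x + 3 * deriv (fun y => h y ^ 3 * deriv h y) x)
        =O[𝓝[<] 1] fun x => (1 - x) ^ (-(1 : ℝ) / 2))
    ∧ ∃ c : ℝ, c ≠ 0 ∧
        Tendsto (fun x => (1 - x) ^ ((1 : ℝ) / 2)
            * (x * deriv h x + 3 * deriv (fun y => h y ^ 3 * deriv h y) x))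
          (𝓝[<] 1) (𝓝 c) := by
  set t : ℝ → ℝ := fun y => (1 - y) ^ ((1 : ℝ) / 6) with ht
  have htpos : ∀ x ∈ Set.Ioo (0 : ℝ) 1, 0 < t x := fun x hx =>
    Real.rpow_pos_of_pos (sub_pos.2 hx.2) _
  have htderiv : ∀ x ∈ Set.Ioo (0 : ℝ) 1, HasDerivAt t (-(1 / 6) / t x ^ 5) x := fun x hx =>
    hasDerivAt_one_sub_rpow_sixth hx.2
  have hsqrt : ∀ x ∈ Set.Ioo (0 : ℝ) 1, (1 - x) ^ ((1 : ℝ) / 2) = t x ^ 3 := fun x hx => by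
    rw [ht, one_sub_rpow_sixth_pow hx.2]
    norm_num
  have hx_eq : ∀ x ∈ Set.Ioo (0 : ℝ) 1, x = 1 - t x ^ 6 := fun x hx => by
    rw [ht, one_sub_rpow_sixth_pow hx.2]
    norm_num
  have hh_eq : ∀ x ∈ Set.Ioo (0 : ℝ) 1, h x = t x ^ 2 + 1 / 5 * t x ^ 3 := fun x hx => by
    have hcube : (1 - x) ^ ((1 : ℝ) / 3) = t x ^ 2 := by
      rw [ht, one_sub_rpow_sixth_pow hx.2]
      norm_num
    rw [hh x ⟨hx.1.le, hx.2⟩, hcube]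
    ring
  have hderiv : ∀ x ∈ Set.Ioo (0 : ℝ) 1,
      deriv h x = -(1 / 3) / t x ^ 4 - 1 / 10 / t x ^ 3 := fun x hx => by
    have hev : h =ᶠ[𝓝 x] fun y => t y ^ 2 + 1 / 5 * t y ^ 3 :=
      eventually_of_mem (isOpen_Ioo.mem_nhds hx) hh_eq
    have hd := ((htderiv x hx).pow 2).add (((htderiv x hx).pow 3).const_mul (1 / 5))
    refine (HasDerivAt.congr_of_eventuallyEq hd hev).deriv.trans ?_
    have := (htpos x hx).ne'
    field_simp
    ring
  have hflux : ∀ x ∈ Set.Ioo (0 : ℝ) 1, h x ^ 3 * deriv h x =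
      -(t x ^ 2 * ((1 + 1 / 5 * t x) ^ 3 * (1 / 3 + 1 / 10 * t x))) := fun x hx => by
    rw [hderiv x hx, hh_eq x hx]
    have := (htpos x hx).ne'
    field_simp
    ring
  have hfluxderiv : ∀ x ∈ Set.Ioo (0 : ℝ) 1, deriv (fun y => h y ^ 3 * deriv h y) x =
      1 / 6 / t x ^ 5 * (2 / 3 * t x + 9 / 10 * t x ^ 2 + 2 / 5 * t x ^ 3
        + 11 / 150 * t x ^ 4 + 3 / 625 * t x ^ 5) := fun x hx => by
    have hev : (fun y => h y ^ 3 * deriv h y) =ᶠ[𝓝 x] fun y =>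
        -(t y ^ 2 * ((1 + 1 / 5 * t y) ^ 3 * (1 / 3 + 1 / 10 * t y))) :=
      eventually_of_mem (isOpen_Ioo.mem_nhds hx) hflux
    have hd := (((htderiv x hx).pow 2).mul
      (((((htderiv x hx).const_mul (1 / 5)).const_add 1).pow 3).mul
        (((htderiv x hx).const_mul (1 / 10)).const_add (1 / 3)))).neg
    refine (HasDerivAt.congr_of_eventuallyEq hd hev).deriv.trans ?_
    have := (htpos x hx).ne'
    simp only [Pi.mul_apply, Pi.pow_apply]
    field_simp
    ring
  have hnear : ∀ᶠ x in 𝓝[<] (1 : ℝ), x ∈ Set.Ioo (0 : ℝ) 1 :=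
    Ioo_mem_nhdsLT zero_lt_one
  have htlim : Tendsto t (𝓝[<] 1) (𝓝 0) := by
    have hcont : ContinuousAt t 1 :=
      (continuousAt_const.sub continuousAt_id).rpow_const (Or.inr (by norm_num))
    have h1 : t 1 = 0 := by norm_num [ht]
    exact h1 ▸ hcont.tendsto.mono_left nhdsWithin_le_nhds
  have hlim : Tendsto (fun x => (1 - x) ^ ((1 : ℝ) / 2)
      * (x * deriv h x + 3 * deriv (fun y => h y ^ 3 * deriv h y) x))
      (𝓝[<] 1) (𝓝 (7 / 20)) := by
    have hpoly : Continuous fun s : ℝ => 7 / 20 + 1 / 5 * s + 11 / 300 * s ^ 2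
        + 3 / 1250 * s ^ 3 + 1 / 3 * s ^ 5 + 1 / 10 * s ^ 6 := by fun_prop
    have hcomp := (hpoly.tendsto 0).comp htlim
    norm_num only at hcomp
    refine hcomp.congr' ?_
    filter_upwards [hnear] with x hx
    rw [hsqrt x hx, hderiv x hx, hfluxderiv x hx]
    have hne := (htpos x hx).ne'
    have hxt := hx_eq x hx
    simp only [Function.comp_apply]
    generalize t x = s at hne hxt ⊢
    rw [hxt]
    field_simp
    ring
  refine ⟨?_, 7 / 20, by norm_num, hlim⟩
  have hmul := (hlim.isBigO_one ℝ).mul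
    (isBigO_refl (fun x : ℝ => (1 - x) ^ (-(1 : ℝ) / 2)) (𝓝[<] 1))
  refine hmul.congr' ?_ (by simp)
  filter_upwards [hnear] with x hx
  have hpos : 0 < 1 - x := sub_pos.2 hx.2
  have hinv : (1 - x) ^ ((1 : ℝ) / 2) * (1 - x) ^ (-(1 : ℝ) / 2) = 1 := by
    rw [← Real.rpow_add hpos]
    norm_num
  rw [mul_right_comm, hinv, one_mul]
end

section
/- Let β be real, u0 > 0 and q0* real. Let u : [0, 1] → ℝ be continuous with u(1) = 0, continuously differentiable on (0, 1), and write u(x) = u0·(1 − x)^(1/3) + Δu(x) with Δu integrable on (0, 1). Let q_l* be integrable on (0, 1). Assume: (i) u satisfies β·u0³·(u(x) + q_l*(x)) = x·u0³·u'(x) + 3·(u³u')'(x) for all x ∈ (0, 1); (ii) the function x ↦ u(x)³u'(x) extends continuously to [0, 1] with limit 0 at x = 1 and with −3·u0^(−3/2)·u(0)³·u'(0⁺) = q0* at x = 0; (iii) u' is improperly integrable on (0, 1) and the fundamental theorem of calculus applies to u³u' on [0, 1]. Then (3/4)·(β + 1)·u0^(5/2) + u0^(3/2)·[ (β + 1)·∫₀¹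 Δu(x) dx + β·∫₀¹ q_l*(x) dx ] − q0* = 0. -/
open MeasureTheory

/-- Integration by parts against the identity for a function vanishing at `1`. -/
theorem integral_id_mul_deriv_of_eq_zero {u : ℝ → ℝ}
    (hucont : ContinuousOn u (Set.Icc 0 1)) (hu1 : u 1 = 0)
    (hudiff : ∀ x ∈ Set.Ioo (0 : ℝ) 1, DifferentiableAt ℝ u x)
    (hu'int : IntervalIntegrable (deriv u) volume 0 1) :
    ∫ x in (0 : ℝ)..1, x * deriv u x = -∫ x in (0 : ℝ)..1, u x := by
  have hu : IntervalIntegrable u volume 0 1 :=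
    ContinuousOn.intervalIntegrable_of_Icc zero_le_one hucont
  have hxu' : IntervalIntegrable (fun x => x * deriv u x) volume 0 1 :=
    hu'int.continuousOn_mul continuousOn_id
  have h := intervalIntegral.integral_eq_sub_of_hasDerivAt_of_le
    (f := fun x => x * u x) (f' := fun x => u x + x * deriv u x) zero_le_one
    (continuousOn_id.mul hucont)
    (fun x hx => by simpa using (hasDerivAt_id' x).fun_mul (hudiff x hx).hasDerivAt)
    (hu.add hxu')
  rw [intervalIntegral.integral_add hu hxu'] at h
  simp only [hu1, mul_zero, zero_mul, sub_zero] at h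
  linarith

/-- The integral of the tip asymptotics `(1 - x) ^ (1 / 3)` over the unit interval. -/
theorem integral_one_sub_rpow_one_third :
    ∫ x in (0 : ℝ)..1, (1 - x) ^ ((1 : ℝ) / 3) = 3 / 4 := by
  rw [intervalIntegral.integral_comp_sub_left (fun x : ℝ => x ^ ((1 : ℝ) / 3)) 1,
    integral_rpow (Or.inl (by norm_num))]
  norm_num

/-- Integrating the self-similar PKN ODE `β u0³ (u + q_l*) = x u0³ u' + 3 (u³u')'`
over `(0,1)` with the tip representation `u(x) = u0 (1-x)^(1/3) + Δu(x)`, the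
zero-flux tip condition (the continuous extension `Φ` of `u³u'` vanishes at `1`)
and the inlet flux condition `-3 u0^(-3/2) u(0)³ u'(0⁺) = q0*`, yields the
scalar equation `G₃ = 0`:
`(3/4)(β+1) u0^(5/2) + u0^(3/2) [(β+1)∫₀¹Δu + β∫₀¹q_l*] - q0* = 0`. -/
theorem stmt_19 (β u0 q0star : ℝ) (hu0 : 0 < u0)
    (u Δu qlstar Φ : ℝ → ℝ)
    (hucont : ContinuousOn u (Set.Icc 0 1)) (hu1 : u 1 = 0)
    (hudiff : ∀ x ∈ Set.Ioo (0 : ℝ) 1, DifferentiableAt ℝ u x)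
    (hucont' : ContinuousOn (deriv u) (Set.Ioo 0 1))
    (hrep : ∀ x ∈ Set.Icc (0 : ℝ) 1, u x = u0 * (1 - x) ^ ((1 : ℝ) / 3) + Δu x)
    (hΔint : IntervalIntegrable Δu volume 0 1)
    (hqint : IntervalIntegrable qlstar volume 0 1)
    (hODE : ∀ x ∈ Set.Ioo (0 : ℝ) 1,
      β * u0 ^ 3 * (u x + qlstar x)
        = x * u0 ^ 3 * deriv u x + 3 * deriv (fun y => u y ^ 3 * deriv u y) x)
    (hΦcont : ContinuousOn Φ (Set.Icc 0 1))
    (hΦ : ∀ x ∈ Set.Ioo (0 : ℝ) 1, Φ x = u x ^ 3 * deriv u x)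
    (hΦ1 : Φ 1 = 0)
    (hΦ0 : -3 * u0 ^ (-(3 : ℝ) / 2) * Φ 0 = q0star)
    (hu'int : IntervalIntegrable (deriv u) volume 0 1)
    (hFTC : ∫ x in (0 : ℝ)..1, deriv (fun y => u y ^ 3 * deriv u y) x = Φ 1 - Φ 0) :
    (3 / 4) * (β + 1) * u0 ^ ((5 : ℝ) / 2)
        + u0 ^ ((3 : ℝ) / 2) * ((β + 1) * (∫ x in (0 : ℝ)..1, Δu x)
            + β * ∫ x in (0 : ℝ)..1, qlstar x)
        - q0star = 0 := by
  have hu : IntervalIntegrable u volume 0 1 :=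
    ContinuousOn.intervalIntegrable_of_Icc zero_le_one hucont
  have hxu' : IntervalIntegrable (fun x => x * deriv u x) volume 0 1 :=
    hu'int.continuousOn_mul continuousOn_id
  have htip : IntervalIntegrable (fun x : ℝ => u0 * (1 - x) ^ ((1 : ℝ) / 3)) volume 0 1 :=
    Continuous.intervalIntegrable
      (continuous_const.mul ((continuous_const.sub continuous_id).rpow_const
        fun _ => Or.inr (by norm_num))) _ _
  have hU : ∫ x in (0 : ℝ)..1, u x = 3 / 4 * u0 + ∫ x in (0 : ℝ)..1, Δu x := by
    rw [intervalIntegral.integral_congr (g := fun x => u0 * (1 - x) ^ ((1 : ℝ) / 3) + Δu x)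
        (fun x hx => hrep x (by rwa [Set.uIcc_of_le zero_le_one] at hx)),
      intervalIntegral.integral_add htip hΔint, intervalIntegral.integral_const_mul,
      integral_one_sub_rpow_one_third]
    ring
  have hflux : 3 * ∫ x in (0 : ℝ)..1, deriv (fun y => u y ^ 3 * deriv u y) x
      = β * u0 ^ 3 * ((∫ x in (0 : ℝ)..1, u x) + ∫ x in (0 : ℝ)..1, qlstar x)
        - u0 ^ 3 * ∫ x in (0 : ℝ)..1, x * deriv u x := by
    rw [← intervalIntegral.integral_add hu hqint, ← intervalIntegral.integral_const_mul,
      ← intervalIntegral.integral_const_mul, ← intervalIntegral.integral_const_mul,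
      ← intervalIntegral.integral_sub ((hu.add hqint).const_mul _) (hxu'.const_mul _)]
    simp only [intervalIntegral.integral_of_le (zero_le_one' ℝ), integral_Ioc_eq_integral_Ioo]
    refine setIntegral_congr_fun measurableSet_Ioo fun x hx => ?_
    linear_combination -hODE x hx
  rw [integral_id_mul_deriv_of_eq_zero hucont hu1 hudiff hu'int, hFTC, hΦ1, hU] at hflux
  have h32 : u0 ^ ((3 : ℝ) / 2) = u0 ^ (-(3 : ℝ) / 2) * u0 ^ 3 := by
    rw [← Real.rpow_natCast u0 3, ← Real.rpow_add hu0]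
    norm_num
  have h52 : u0 ^ ((5 : ℝ) / 2) = u0 ^ (-(3 : ℝ) / 2) * u0 ^ 3 * u0 := by
    rw [← h32, ← Real.rpow_add_one hu0.ne']
    norm_num
  rw [h52, h32, ← hΦ0]
  linear_combination -u0 ^ (-(3 : ℝ) / 2) * hflux
end
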